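/- Let A and B be algebras of the same signature, let f : A → B be a surjective homomorphism, and let π = {(x,y) ∈ A² : f(x)=f(y)} be its kernel congruence. Suppose the signature has terms inducing Day operations on A (hence, via f, also on B). Let k ≥ 2 and θ₀,…,θ_{k-1} ∈ Con(A). Then [θ₀,…,θ_{k-1}] ∨ π = f⁻¹([f(θ₀ ∨ π),…,f(θ_{k-1} ∨ π)]), where for γ ∈ Con(A) with γ ≥ π, f(γ) = {(f(x),f(y)) : (x,y) ∈ γ} ∈ Con(B), f⁻¹(β) = {(x,y) ∈ A² : (f(x),f(y)) ∈ β} for β ∈ Con(B), and the commutator on the right-hand side is computed in B. -/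

import Mathlib

namespace UACommutator

/-- A signature: a type of operation symbols with arities. -/
structure Signature where
  ops : Type
  arity : ops → ℕ

/-- An algebra for a signature: a nonempty carrier with interpretations of the operations. -/
structure Alg (σ : Signature) where
  carrier : Type
  nonempty : Nonempty carrier
  interp : (o : σ.ops) → (Fin (σ.arity o) → carrier) → carrier

/-- A congruence of an algebra: an equivalence relation compatible with all basic operations. -/
structure Congruence {σ : Signature} (A : Alg σ) where
  rel : A.carrier → A.carrier → Prop
  iseqv : Equivalence rel
  compat : ∀ (o : σ.ops) (x y : Fin (σ.arity o) → A.carrier),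
    (∀ i, rel (x i) (y i)) → rel (A.interp o x) (A.interp o y)

instance {σ : Signature} {A : Alg σ} : LE (Congruence A) :=
  ⟨fun a b => ∀ x y, a.rel x y → b.rel x y⟩

/-- Terms of the signature with variables in `V`. -/
inductive Term (σ : Signature) (V : Type) : Type
  | var : V → Term σ V
  | app : (o : σ.ops) → (Fin (σ.arity o) → Term σ V) → Term σ V

def Term.evalA {σ : Signature} (A : Alg σ) {V : Type} :
    Term σ V → (V → A.carrier) → A.carrier
  | .var v, env => env v
  | .app o args, env => A.interp o (fun i => (args i).evalA A env)

/-- Polynomial operations of an algebra `A` with variables in `V`: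
built from variables, constants of `A`, and the basic operations. -/
inductive Poly {σ : Signature} (A : Alg σ) (V : Type) : Type
  | var : V → Poly A V
  | const : A.carrier → Poly A V
  | app : (o : σ.ops) → (Fin (σ.arity o) → Poly A V) → Poly A V

def Poly.eval {σ : Signature} {A : Alg σ} {V : Type} :
    Poly A V → (V → A.carrier) → A.carrier
  | .var v, env => env v
  | .const c, _ => c
  | .app o args, env => A.interp o (fun i => (args i).eval env)

/-- Evaluate a polynomial whose variables are grouped into `k` tuples (tuple `i` of
length `ν i`) at the tuples `a i` (where `g i = false`) or `b i` (where `g i = true`). -/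
def evalTup {σ : Signature} {A : Alg σ} {k : ℕ} {ν : Fin k → ℕ}
    (p : Poly A (Σ i, Fin (ν i))) (a b : ∀ i, Fin (ν i) → A.carrier)
    (g : Fin k → Bool) : A.carrier :=
  p.eval (fun x => if g x.1 then b x.1 x.2 else a x.1 x.2)

/-- The term condition `C(α₀,…,α_{k-1}; δ)`, centralizing at coordinate `j`. -/
def TC {σ : Signature} {A : Alg σ} {k : ℕ} (α : Fin k → Congruence A) (j : Fin k)
    (δ : Congruence A) : Prop :=
  ∀ (ν : Fin k → ℕ) (p : Poly A (Σ i, Fin (ν i)))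
    (a b : ∀ i, Fin (ν i) → A.carrier),
    (∀ i mm, (α i).rel (a i mm) (b i mm)) →
    (∀ g : Fin k → Bool, g j = false → (∃ i, i ≠ j ∧ g i = false) →
      δ.rel (evalTup p a b g) (evalTup p a b (Function.update g j true))) →
    δ.rel (evalTup p a b (Function.update (fun _ => true) j false))
          (evalTup p a b (fun _ => true))

/-- The meet (intersection) of a family of congruences. -/
def infCong {σ : Signature} {A : Alg σ} {ι : Sort*} (ds : ι → Congruence A) :
    Congruence A where
  rel x y := ∀ i, (ds i).rel x y
  iseqv := ⟨fun x i => (ds i).iseqv.refl x,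
            fun h i => (ds i).iseqv.symm (h i),
            fun h h' i => (ds i).iseqv.trans (h i) (h' i)⟩
  compat o x y h := fun i => (ds i).compat o x y (fun mm => h mm i)

/-- The higher commutator `[α₀,…,α_{k-1}]` (term-condition version), as the meet of
all congruences `δ` such that `C(α₀,…,α_{k-1}; δ)` holds, centralizing at `j`. -/
def commTC {σ : Signature} {A : Alg σ} {k : ℕ} (α : Fin k → Congruence A) (j : Fin k) :
    Congruence A :=
  infCong (fun d : {δ : Congruence A // TC α j δ} => d.val)

/-- The congruence generated by a binary relation `X`. -/
def Cg {σ : Signature} {A : Alg σ} (X : A.carrier → A.carrier → Prop) : Congruence A :=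
  infCong (fun d : {δ : Congruence A // ∀ x y, X x y → δ.rel x y} => d.val)

theorem Cg_base {σ : Signature} {A : Alg σ} (X : A.carrier → A.carrier → Prop)
    {x y : A.carrier} (h : X x y) : (Cg X).rel x y :=
  fun i => i.2 x y h

/-- The join of a family of congruences: the least congruence containing every member. -/
def supCong {σ : Signature} {A : Alg σ} {ι : Sort*} (γ : ι → Congruence A) :
    Congruence A :=
  Cg (fun x y => ∃ i, (γ i).rel x y)

/-- The join of two congruences. -/
def joinCong {σ : Signature} {A : Alg σ} (a b : Congruence A) : Congruence A :=
  Cg (fun x y => a.rel x y ∨ b.rel x y)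

/-- `m` is a `T`-matrix for `T = (θ₀,…,θ_{k-1})`. -/
def IsMatrix {σ : Signature} {A : Alg σ} {k : ℕ} (θ : Fin k → Congruence A)
    (m : (Fin k → Bool) → A.carrier) : Prop :=
  ∃ (ν : Fin k → ℕ) (p : Poly A (Σ i, Fin (ν i))) (a b : ∀ i, Fin (ν i) → A.carrier),
    (∀ i jj, (θ i).rel (a i jj) (b i jj)) ∧
    ∀ f : Fin k → Bool, m f = evalTup p a b f

/-- The matrix centralization condition `C(T; j; δ)`: for every `T`-matrix, if every
`(j)`-supporting line is a `δ`-pair then the `(j)`-pivot line is a `δ`-pair. -/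
def CMat {σ : Signature} {A : Alg σ} {k : ℕ} (θ : Fin k → Congruence A) (j : Fin k)
    (δ : Congruence A) : Prop :=
  ∀ m : (Fin k → Bool) → A.carrier, IsMatrix θ m →
    (∀ g : Fin k → Bool, (∃ i, i ≠ j ∧ g i = false) →
      δ.rel (m (Function.update g j false)) (m (Function.update g j true))) →
    δ.rel (m (Function.update (fun _ => true) j false)) (m (fun _ => true))

/-- `[T]_j`: the meet of all congruences `δ` with `C(T; j; δ)`. -/
def commMat {σ : Signature} {A : Alg σ} {k : ℕ} (θ : Fin k → Congruence A) (j : Fin k) :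
    Congruence A :=
  infCong (fun d : {δ : Congruence A // CMat θ j δ} => d.val)

/-- Day operations `m₀, …, m_n` for an algebra, each induced by a term of the signature. -/
structure DayOps {σ : Signature} (A : Alg σ) (n : ℕ) where
  m : Fin (n+1) → A.carrier → A.carrier → A.carrier → A.carrier → A.carrier
  isTerm : ∀ e, ∃ t : Term σ (Fin 4), ∀ x y z u, m e x y z u = t.evalA A ![x, y, z, u]
  idem : ∀ e x y, m e x y y x = x
  first : ∀ x y z u, m 0 x y z u = x
  last : ∀ x y z u, m (Fin.last n) x y z u = u
  even : ∀ (e : ℕ) (he : e < n), Even e → ∀ x u,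
    m ⟨e, by omega⟩ x x u u = m ⟨e+1, by omega⟩ x x u u
  odd : ∀ (e : ℕ) (he : e < n), Odd e → ∀ x y u,
    m ⟨e, by omega⟩ x y y u = m ⟨e+1, by omega⟩ x y y u

/-- The `e`-th shift rotation at `(j, l)` of a cube `h`. -/
def shiftRot {σ : Signature} {A : Alg σ} {n k : ℕ} (D : DayOps A n) (e : Fin (n+1))
    (j l : Fin k) (h : (Fin k → Bool) → A.carrier) :
    (Fin k → Bool) → A.carrier := fun f =>
  let r := h (Function.update (Function.update f j false) l false)
  let s := h (Function.update (Function.update f j false) l true)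
  let u := h (Function.update (Function.update f j true) l false)
  let v := h (Function.update (Function.update f j true) l true)
  if f j then (if f l then D.m e s s v v else D.m e s r u v) else s

/-- `hIter D m hm d h` is `h^{(d₀,…,d_{m-1})}`: the result of applying the shift
rotations `R^{d₀}_{0,1}, …, R^{d_{m-1}}_{m-1,m}` successively to `h`. -/
def hIter {σ : Signature} {A : Alg σ} {n k : ℕ} (D : DayOps A n) :
    (m : ℕ) → m < k → (Fin m → Fin (n+1)) → ((Fin k → Bool) → A.carrier) →
    ((Fin k → Bool) → A.carrier)
  | 0, _, _, h => h
  | (m+1), hm, d, h =>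
      shiftRot D (d (Fin.last m)) ⟨m, by omega⟩ ⟨m+1, hm⟩
        (hIter D m (by omega) (fun i => d i.castSucc) h)

/-- `X(T)`: the set of `(k-1)`-pivot lines of the matrices `h^d`, over all `T`-matrices
`h` and all `d ∈ {0,…,n}^{k-1}`. -/
def XSet {σ : Signature} {A : Alg σ} {n k : ℕ} (hk : 0 < k) (D : DayOps A n)
    (θ : Fin k → Congruence A) : A.carrier → A.carrier → Prop :=
  fun x y => ∃ h : (Fin k → Bool) → A.carrier, IsMatrix θ h ∧
    ∃ d : Fin (k-1) → Fin (n+1),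
      x = hIter D (k-1) (by omega) d h
            (Function.update (fun _ => true) (⟨k-1, by omega⟩ : Fin k) false) ∧
      y = hIter D (k-1) (by omega) d h (fun _ => true)

/-- Product algebra `A^I` with pointwise operations. -/
def prodAlg {σ : Signature} (A : Alg σ) (I : Type) : Alg σ where
  carrier := I → A.carrier
  nonempty := ⟨fun _ => Classical.choice A.nonempty⟩
  interp o x := fun i => A.interp o (fun mm => x mm i)

/-- Membership in the subalgebra of `B` generated by a set `S`. -/
inductive Gen {σ : Signature} (B : Alg σ) (S : Set B.carrier) : B.carrier → Prop
  | base : ∀ x ∈ S, Gen B S x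
  | app : ∀ (o : σ.ops) (x : Fin (σ.arity o) → B.carrier),
      (∀ i, Gen B S (x i)) → Gen B S (B.interp o x)

/-- `f : A → B` is a homomorphism. -/
def IsHom {σ : Signature} (A B : Alg σ) (f : A.carrier → B.carrier) : Prop :=
  ∀ (o : σ.ops) (x : Fin (σ.arity o) → A.carrier),
    f (A.interp o x) = B.interp o (fun i => f (x i))

/-- The kernel congruence of a homomorphism. -/
def kerCong {σ : Signature} {A B : Alg σ} (f : A.carrier → B.carrier)
    (hf : IsHom A B f) : Congruence A where
  rel x y := f x = f y
  iseqv := ⟨fun _ => rfl, Eq.symm, Eq.trans⟩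
  compat o x y h := by
    show f (A.interp o x) = f (A.interp o y)
    rw [hf o x, hf o y]
    congr 1
    funext i
    exact h i

/-- The image `f(γ)` of a congruence `γ ≥ ker f` under a surjective homomorphism `f`. -/
def mapCong {σ : Signature} {A B : Alg σ} (f : A.carrier → B.carrier)
    (hf : IsHom A B f) (hs : Function.Surjective f) (γ : Congruence A)
    (hγ : ∀ x y, f x = f y → γ.rel x y) : Congruence B where
  rel u v := ∃ x y, γ.rel x y ∧ f x = u ∧ f y = v
  iseqv := by
    refine ⟨?_, ?_, ?_⟩
    · intro u
      obtain ⟨x, hx⟩ := hs u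
      exact ⟨x, x, γ.iseqv.refl x, hx, hx⟩
    · rintro u v ⟨x, y, hxy, hx, hy⟩
      exact ⟨y, x, γ.iseqv.symm hxy, hy, hx⟩
    · rintro u v w ⟨x, y, hxy, hx, hy⟩ ⟨y', z, hyz, hy', hz⟩
      exact ⟨x, z, γ.iseqv.trans hxy (γ.iseqv.trans (hγ y y' (hy.trans hy'.symm)) hyz),
        hx, hz⟩
  compat o u v h := by
    choose x y hxy hx hy using h
    refine ⟨A.interp o x, A.interp o y, γ.compat o x y hxy, ?_, ?_⟩
    · rw [hf o x]
      congr 1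
      funext i
      exact hx i
    · rw [hf o y]
      congr 1
      funext i
      exact hy i

/-- The preimage `f⁻¹(β)` of a congruence of `B` under a homomorphism `f`. -/
def comapCong {σ : Signature} {A B : Alg σ} (f : A.carrier → B.carrier)
    (hf : IsHom A B f) (β : Congruence B) : Congruence A where
  rel x y := β.rel (f x) (f y)
  iseqv := ⟨fun _ => β.iseqv.refl _, β.iseqv.symm, β.iseqv.trans⟩
  compat o x y h := by
    show β.rel (f (A.interp o x)) (f (A.interp o y))
    rw [hf o x, hf o y]
    exact β.compat o _ _ h

theorem Congruence.ext_rel {σ : Signature} {A : Alg σ} {α β : Congruence A}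
    (h : ∀ x y, α.rel x y ↔ β.rel x y) : α = β := by
  cases α
  cases β
  congr
  funext x y
  exact propext (h x y)

/-! ### Terms and polynomials -/

theorem Term.evalA_congr {σ : Signature} {A : Alg σ} {V : Type} (δ : Congruence A)
    (t : Term σ V) {x y : V → A.carrier} (h : ∀ v, δ.rel (x v) (y v)) :
    δ.rel (t.evalA A x) (t.evalA A y) := by
  induction t with
  | var v => exact h v
  | app o args ih => exact δ.compat o _ _ ih

/-- Substitution of polynomials for the variables of a term. -/
def Term.subst {σ : Signature} {A : Alg σ} {V W : Type} (s : V → Poly A W) :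
    Term σ V → Poly A W
  | .var v => s v
  | .app o args => .app o (fun i => (args i).subst s)

theorem Term.eval_subst {σ : Signature} {A : Alg σ} {V W : Type} (s : V → Poly A W)
    (t : Term σ V) (env : W → A.carrier) :
    (t.subst s).eval env = t.evalA A (fun v => (s v).eval env) := by
  induction t with
  | var v => rfl
  | app o args ih => simp only [Term.subst, Poly.eval, Term.evalA, ih]

theorem Poly.eval_congr {σ : Signature} {A : Alg σ} {V : Type} (δ : Congruence A)
    (p : Poly A V) {x y : V → A.carrier} (h : ∀ v, δ.rel (x v) (y v)) :
    δ.rel (p.eval x) (p.eval y) := by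
  induction p with
  | var v => exact h v
  | const c => exact δ.iseqv.refl c
  | app o args ih => exact δ.compat o _ _ ih

/-- Substitution of polynomials for the variables of a polynomial. -/
def Poly.bind {σ : Signature} {A : Alg σ} {V W : Type} (s : V → Poly A W) :
    Poly A V → Poly A W
  | .var v => s v
  | .const c => .const c
  | .app o args => .app o (fun i => (args i).bind s)

theorem Poly.eval_bind {σ : Signature} {A : Alg σ} {V W : Type} (s : V → Poly A W)
    (p : Poly A V) (env : W → A.carrier) :
    (p.bind s).eval env = p.eval (fun v => (s v).eval env) := by
  induction p with
  | var v => rfl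
  | const c => rfl
  | app o args ih => simp only [Poly.bind, Poly.eval, ih]

/-- Transport of a polynomial along a map applied to its constants. -/
def Poly.map {σ : Signature} {A B : Alg σ} {V : Type} (f : A.carrier → B.carrier) :
    Poly A V → Poly B V
  | .var v => .var v
  | .const c => .const (f c)
  | .app o args => .app o (fun i => (args i).map f)

theorem Poly.eval_map {σ : Signature} {A B : Alg σ} {V : Type} {f : A.carrier → B.carrier}
    (hf : IsHom A B f) (p : Poly A V) (env : V → A.carrier) :
    (p.map f).eval (fun v => f (env v)) = f (p.eval env) := by
  induction p with
  | var v => rfl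
  | const c => rfl
  | app o args ih => simp only [Poly.map, Poly.eval, ih, hf o]

theorem Poly.map_surjective {σ : Signature} {A B : Alg σ} {V : Type}
    {f : A.carrier → B.carrier} (hs : Function.Surjective f) :
    Function.Surjective (Poly.map f : Poly A V → Poly B V) := by
  intro p
  induction p with
  | var v => exact ⟨.var v, rfl⟩
  | const c =>
    obtain ⟨x, rfl⟩ := hs c
    exact ⟨.const x, rfl⟩
  | app o args ih =>
    choose q hq using ih
    exact ⟨.app o q, by simp only [Poly.map, hq]⟩

theorem evalTup_map {σ : Signature} {A B : Alg σ} {f : A.carrier → B.carrier}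
    (hf : IsHom A B f) {k : ℕ} {ν : Fin k → ℕ} (p : Poly A (Σ i, Fin (ν i)))
    (a b : ∀ i, Fin (ν i) → A.carrier) (g : Fin k → Bool) :
    evalTup (p.map f) (fun i m => f (a i m)) (fun i m => f (b i m)) g =
      f (evalTup p a b g) := by
  rw [evalTup, evalTup, ← Poly.eval_map hf]
  congr 1
  funext x
  split_ifs <;> rfl

theorem evalTup_congr_env {σ : Signature} {A : Alg σ} {k : ℕ} {ν : Fin k → ℕ}
    (p : Poly A (Σ i, Fin (ν i))) {a b a' b' : ∀ i, Fin (ν i) → A.carrier}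
    {g g' : Fin k → Bool}
    (h : ∀ i, (if g i then b i else a i) = if g' i then b' i else a' i) :
    evalTup p a b g = evalTup p a' b' g' := by
  rw [evalTup, evalTup]
  congr 1
  funext x
  have := congrFun (h x.1) x.2
  split_ifs at this ⊢ <;> exact this

theorem evalTup_update_of_eq_false {σ : Signature} {A : Alg σ} {k : ℕ} {ν : Fin k → ℕ}
    (p : Poly A (Σ i, Fin (ν i))) (a b : ∀ i, Fin (ν i) → A.carrier) {i : Fin k}
    (x y : Fin (ν i) → A.carrier) {f : Fin k → Bool} (hf : f i = false) :
    evalTup p (Function.update a i x) (Function.update b i y) f =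
      evalTup p (Function.update a i x) (Function.update b i x) f := by
  refine evalTup_congr_env p fun i' => ?_
  by_cases hi : i' = i
  · subst hi
    simp [hf]
  · simp [hi]

theorem evalTup_update_of_eq_true {σ : Signature} {A : Alg σ} {k : ℕ} {ν : Fin k → ℕ}
    (p : Poly A (Σ i, Fin (ν i))) (a b : ∀ i, Fin (ν i) → A.carrier) {i : Fin k}
    (x y : Fin (ν i) → A.carrier) {f : Fin k → Bool} (hf : f i = true) :
    evalTup p (Function.update a i x) (Function.update b i y) f =
      evalTup p (Function.update a i y) (Function.update b i y) f := by
  refine evalTup_congr_env p fun i' => ?_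
  by_cases hi : i' = i
  · subst hi
    simp [hf]
  · simp [hi]

/-- Replace the variables of the `j`-th group by constants. -/
def Poly.pin {σ : Signature} {A : Alg σ} {k : ℕ} {ν : Fin k → ℕ} (j : Fin k)
    (c : ∀ i, Fin (ν i) → A.carrier) (p : Poly A (Σ i, Fin (ν i))) :
    Poly A (Σ i, Fin (ν i)) :=
  p.bind (fun x => if x.1 = j then .const (c x.1 x.2) else .var x)

theorem evalTup_pin {σ : Signature} {A : Alg σ} {k : ℕ} {ν : Fin k → ℕ} (j : Fin k)
    (v : Bool) (p : Poly A (Σ i, Fin (ν i))) {a b c : ∀ i, Fin (ν i) → A.carrier}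
    (hc : c j = if v then b j else a j) (g : Fin k → Bool) :
    evalTup (p.pin j c) a b g = evalTup p a b (Function.update g j v) := by
  rw [evalTup, evalTup, Poly.pin, Poly.eval_bind]
  congr 1
  funext ⟨i, m⟩
  by_cases hi : i = j
  · subst hi
    cases v <;> simp_all [Poly.eval]
  · simp [hi, Poly.eval]

/-! ### Day operations and rotations of cubes -/

theorem DayOps.congr {σ : Signature} {A : Alg σ} {n : ℕ} (D : DayOps A n)
    (δ : Congruence A) (e : Fin (n + 1)) {x y z u x' y' z' u' : A.carrier}
    (hx : δ.rel x x') (hy : δ.rel y y') (hz : δ.rel z z') (hu : δ.rel u u') :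
    δ.rel (D.m e x y z u) (D.m e x' y' z' u') := by
  obtain ⟨t, ht⟩ := D.isTerm e
  rw [ht, ht]
  apply t.evalA_congr
  intro v
  fin_cases v <;> assumption

theorem DayOps.rel_of_forall {σ : Signature} {A : Alg σ} {n : ℕ} (D : DayOps A n)
    (δ : Congruence A) {r s u v : A.carrier} (hru : δ.rel r u)
    (h : ∀ e, δ.rel (D.m e s r u v) (D.m e s s v v)) : δ.rel s v := by
  have key : ∀ (e : ℕ) (he : e < n + 1), δ.rel s (D.m ⟨e, he⟩ s s v v) := by
    intro e
    induction e with
    | zero =>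
      intro he
      have := D.first s s v v
      rw [show (⟨0, he⟩ : Fin (n + 1)) = 0 from rfl, this]
      exact δ.iseqv.refl s
    | succ e ih =>
      intro he
      refine δ.iseqv.trans (ih (by omega)) ?_
      rcases Nat.even_or_odd e with hev | hodd
      · rw [D.even e (by omega) hev]
        exact δ.iseqv.refl _
      · have aux : ∀ e, δ.rel (D.m e s s v v) (D.m e s r r v) := fun e =>
          δ.iseqv.trans (δ.iseqv.symm (h e)) (D.congr δ e (δ.iseqv.refl _) (δ.iseqv.refl _)
            (δ.iseqv.symm hru) (δ.iseqv.refl _))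
        refine δ.iseqv.trans (aux _) ?_
        rw [D.odd e (by omega) hodd]
        exact δ.iseqv.symm (aux _)
  have := key n (by omega)
  rwa [show (⟨n, by omega⟩ : Fin (n + 1)) = Fin.last n from rfl, D.last] at this

/-- The line of the cube `h` through `f` in direction `j` is a `δ`-pair. -/
def LineRel {σ : Signature} {A : Alg σ} {k : ℕ} (δ : Congruence A)
    (h : (Fin k → Bool) → A.carrier) (j : Fin k) (f : Fin k → Bool) : Prop :=
  δ.rel (h (Function.update f j false)) (h (Function.update f j true))

/-- The cube obtained by applying the `e`-th Day operation to `h` and its degeneracies in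
directions `j` and `l`. By idempotence it agrees with `shiftRot D e j l h` for `j ≠ l`, but it
is visibly a polynomial in the data defining `h`. -/
def rotate {σ : Signature} {A : Alg σ} {n k : ℕ} (D : DayOps A n) (e : Fin (n + 1))
    (j l : Fin k) (h : (Fin k → Bool) → A.carrier) (f : Fin k → Bool) : A.carrier :=
  D.m e (h (Function.update (Function.update f j false) l true))
    (h (Function.update f j false)) (h f) (h (Function.update f l true))

section Rotation

variable {σ : Signature} {A : Alg σ} {n k : ℕ} (D : DayOps A n) {j l : Fin k}

theorem rotate_update_false (hjl : j ≠ l) (e : Fin (n + 1))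
    (h : (Fin k → Bool) → A.carrier) (f : Fin k → Bool) :
    rotate D e j l h (Function.update f l false) =
      D.m e (h (Function.update (Function.update f l true) j false))
        (h (Function.update (Function.update f l false) j false))
        (h (Function.update f l false)) (h (Function.update f l true)) := by
  simp [rotate, Function.update_comm hjl]

theorem rotate_update_true (hjl : j ≠ l) (e : Fin (n + 1))
    (h : (Fin k → Bool) → A.carrier) (f : Fin k → Bool) :
    rotate D e j l h (Function.update f l true) =
      D.m e (h (Function.update (Function.update f l true) j false))
        (h (Function.update (Function.update f l true) j false))
        (h (Function.update f l true)) (h (Function.update f l true)) := by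
  simp [rotate, Function.update_comm hjl]

theorem lineRel_rotate (hjl : j ≠ l) (e : Fin (n + 1)) (δ : Congruence A)
    {h : (Fin k → Bool) → A.carrier} {f : Fin k → Bool}
    (h₀ : LineRel δ h j (Function.update f l false))
    (h₁ : LineRel δ h j (Function.update f l true)) :
    LineRel δ (rotate D e j l h) l f := by
  have key : ∀ v, δ.rel (h (Function.update (Function.update f l v) j false))
      (h (Function.update f l v)) := by
    intro v
    cases hfj : f j
    · rw [show Function.update (Function.update f l v) j false = Function.update f l v by
        rw [Function.update_eq_self_iff, Function.update_of_ne hjl, hfj]]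
      exact δ.iseqv.refl _
    · have hv : LineRel δ h j (Function.update f l v) := by cases v <;> assumption
      have heq : Function.update (Function.update f l v) j true = Function.update f l v := by
        rw [Function.update_eq_self_iff, Function.update_of_ne hjl, hfj]
      rwa [LineRel, heq] at hv
  rw [LineRel, rotate_update_false D hjl, rotate_update_true D hjl]
  have e₀ := D.congr δ e
    (δ.iseqv.refl (h (Function.update (Function.update f l true) j false))) (key false)
    (δ.iseqv.refl (h (Function.update f l false))) (δ.iseqv.symm (key true))
  have e₁ := D.congr δ e
    (δ.iseqv.refl (h (Function.update (Function.update f l true) j false)))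
    (δ.iseqv.refl (h (Function.update (Function.update f l true) j false)))
    (δ.iseqv.symm (key true)) (δ.iseqv.symm (key true))
  rw [D.idem] at e₀ e₁
  exact δ.iseqv.trans e₀ (δ.iseqv.symm e₁)

theorem lineRel_rotate_of_eq_false (hjl : j ≠ l) (e : Fin (n + 1)) (δ : Congruence A)
    (h : (Fin k → Bool) → A.carrier) {f : Fin k → Bool} (hf : f j = false) :
    LineRel δ (rotate D e j l h) l f := by
  have key : ∀ v, Function.update (Function.update f l v) j false = Function.update f l v := by
    intro v
    rw [Function.update_eq_self_iff, Function.update_of_ne hjl, hf]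
  rw [LineRel, rotate_update_false D hjl, rotate_update_true D hjl, key, key, D.idem, D.idem]
  exact δ.iseqv.refl _

theorem lineRel_of_rotate (hjl : j ≠ l) (δ : Congruence A)
    {h : (Fin k → Bool) → A.carrier}
    (h₀ : LineRel δ h j (Function.update (fun _ => true) l false))
    (hr : ∀ e, LineRel δ (rotate D e j l h) l (fun _ => true)) :
    LineRel δ h j (fun _ => true) := by
  have hj : ∀ v, Function.update (Function.update (fun _ => true) l v) j true =
      Function.update (fun _ : Fin k => true) l v := fun v => by
    rw [Function.update_eq_self_iff, Function.update_of_ne hjl]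
  have hl : Function.update (fun _ : Fin k => true) l true = fun _ => true :=
    Function.update_eq_self l _
  have hj' : Function.update (fun _ : Fin k => true) j true = fun _ => true :=
    Function.update_eq_self j _
  rw [LineRel, hj] at h₀
  rw [LineRel, hj']
  refine D.rel_of_forall δ h₀ fun e => ?_
  have := hr e
  rw [LineRel, rotate_update_false D hjl, rotate_update_true D hjl, hl] at this
  exact this

theorem exists_evalTup_eq_rotate (e : Fin (n + 1)) {ν : Fin k → ℕ}
    (p : Poly A (Σ i, Fin (ν i))) (a b : ∀ i, Fin (ν i) → A.carrier) :
    ∃ q : Poly A (Σ i, Fin (ν i)), ∀ a' b' : ∀ i, Fin (ν i) → A.carrier,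
      a' j = a j → b' l = b l → evalTup q a' b' = rotate D e j l (evalTup p a' b') := by
  obtain ⟨t, ht⟩ := D.isTerm e
  refine ⟨t.subst ![(p.pin l b).pin j a, p.pin j a, p, p.pin l b], fun a' b' ha hb => ?_⟩
  funext f
  have hj : ∀ (q : Poly A (Σ i, Fin (ν i))) g,
      evalTup (q.pin j a) a' b' g = evalTup q a' b' (Function.update g j false) :=
    fun q g => evalTup_pin j false q (by simp [ha]) g
  have hl : ∀ (q : Poly A (Σ i, Fin (ν i))) g,
      evalTup (q.pin l b) a' b' g = evalTup q a' b' (Function.update g l true) :=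
    fun q g => evalTup_pin l true q (by simp [hb]) g
  rw [rotate, ht, ← hl, ← hl, ← hj, ← hj, evalTup, Term.eval_subst]
  congr 1
  funext v
  fin_cases v <;> rfl

end Rotation

/-! ### Centralization for fixed tuples -/

/-- Every cube spanned by the tuples `a` and `b` whose `j`-supporting lines are `δ₀`-pairs has a
`δ₁`-pair as its `j`-pivot line. -/
def Centralizes {σ : Signature} {A : Alg σ} {k : ℕ} {ν : Fin k → ℕ}
    (a b : ∀ i, Fin (ν i) → A.carrier) (j : Fin k) (δ₀ δ₁ : Congruence A) : Prop :=
  ∀ p : Poly A (Σ i, Fin (ν i)),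
    (∀ f : Fin k → Bool, (∃ i, i ≠ j ∧ f i = false) → LineRel δ₀ (evalTup p a b) j f) →
    LineRel δ₁ (evalTup p a b) j (fun _ => true)

theorem TC_iff_centralizes {σ : Signature} {A : Alg σ} {k : ℕ} {α : Fin k → Congruence A}
    {j : Fin k} {δ : Congruence A} :
    TC α j δ ↔ ∀ (ν : Fin k → ℕ) (a b : ∀ i, Fin (ν i) → A.carrier),
      (∀ i m, (α i).rel (a i m) (b i m)) → Centralizes a b j δ δ := by
  have hj : Function.update (fun _ : Fin k => true) j true = fun _ => true :=
    Function.update_eq_self j _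
  constructor
  · intro h ν a b hab p hp
    rw [LineRel, hj]
    refine h ν p a b hab fun g hg hgi => ?_
    have := hp g hgi
    rwa [LineRel, show Function.update g j false = g by
      rw [Function.update_eq_self_iff, hg]] at this
  · intro h ν p a b hab hp
    have := h ν a b hab p fun f ⟨i, hi, hfi⟩ => by
      have := hp (Function.update f j false) (by simp) ⟨i, hi, by simp [hi, hfi]⟩
      rwa [Function.update_idem] at this
    rwa [LineRel, hj] at this

theorem Centralizes.change_direction {σ : Signature} {A : Alg σ} {n k : ℕ} (D : DayOps A n)
    {ν : Fin k → ℕ} {a b : ∀ i, Fin (ν i) → A.carrier} {j l : Fin k} {δ : Congruence A}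
    (hjl : j ≠ l) (h : Centralizes a b l δ δ) : Centralizes a b j δ δ := by
  intro p hp
  refine lineRel_of_rotate D hjl δ (hp _ ⟨l, hjl.symm, by simp⟩) fun e => ?_
  obtain ⟨q, hq⟩ := exists_evalTup_eq_rotate (j := j) (l := l) D e p a b
  rw [← hq a b rfl rfl]
  refine h q ?_
  rintro f ⟨i, hil, hfi⟩
  rw [hq a b rfl rfl]
  by_cases hij : i = j
  · subst hij
    exact lineRel_rotate_of_eq_false D hjl e δ _ hfi
  · exact lineRel_rotate D hjl e δ (hp _ ⟨i, hij, by simp [hil, hfi]⟩)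
      (hp _ ⟨i, hij, by simp [hil, hfi]⟩)

theorem Centralizes.mono {σ : Signature} {A : Alg σ} {n k : ℕ} (D : DayOps A n)
    {ν : Fin k → ℕ} {a b : ∀ i, Fin (ν i) → A.carrier} {δ₀ δ : Congruence A} (hδ : δ₀ ≤ δ)
    (h : ∀ j, Centralizes a b j δ₀ δ₀) (j : Fin k) : Centralizes a b j δ δ := by
  have key : ∀ (S : Finset (Fin k)) (j : Fin k), j ∉ S → ∀ p : Poly A (Σ i, Fin (ν i)),
      (∀ f : Fin k → Bool, (∃ i ∉ S, i ≠ j ∧ f i = false) →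
        LineRel δ₀ (evalTup p a b) j f) →
      (∀ f : Fin k → Bool, (∃ i ∈ S, f i = false) → LineRel δ (evalTup p a b) j f) →
      LineRel δ (evalTup p a b) j (fun _ => true) := by
    intro S
    induction S using Finset.induction_on with
    | empty =>
      intro j _ p hp _
      exact hδ _ _ (h j p fun f ⟨i, hi, hfi⟩ => hp f ⟨i, by simp, hi, hfi⟩)
    | insert l S hl ih =>
      intro j hj p hp₀ hp
      have hjl : j ≠ l := fun h => hj (by simp [h])
      have hjS : j ∉ S := fun h => hj (by simp [h])
      refine lineRel_of_rotate D hjl δ (hp _ ⟨l, by simp, by simp⟩) fun e => ?_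
      obtain ⟨q, hq⟩ := exists_evalTup_eq_rotate (j := j) (l := l) D e p a b
      rw [← hq a b rfl rfl]
      refine ih l hl q ?_ ?_ <;> rw [hq a b rfl rfl]
      · rintro f ⟨i, hiS, hil, hfi⟩
        by_cases hij : i = j
        · subst hij
          exact lineRel_rotate_of_eq_false D hjl e δ₀ _ hfi
        · exact lineRel_rotate D hjl e δ₀
            (hp₀ _ ⟨i, by simp [hil, hiS], hij, by simp [hil, hfi]⟩)
            (hp₀ _ ⟨i, by simp [hil, hiS], hij, by simp [hil, hfi]⟩)
      · rintro f ⟨i, hiS, hfi⟩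
        have hil : i ≠ l := fun h => hl (h ▸ hiS)
        exact lineRel_rotate D hjl e δ
          (hp _ ⟨i, by simp [hiS], by simp [hil, hfi]⟩)
          (hp _ ⟨i, by simp [hiS], by simp [hil, hfi]⟩)
  intro p hp
  refine key (Finset.univ.erase j) j (by simp) p ?_ ?_
  · rintro f ⟨i, hi, hij, -⟩
    simp [hij] at hi
  · rintro f ⟨i, hi, hfi⟩
    exact hp f ⟨i, by simpa using hi, hfi⟩

/-- Centralization passes from the steps of a chain of tuples in one coordinate to its
endpoints. -/
theorem Centralizes.of_reflTransGen {σ : Signature} {A : Alg σ} {n k : ℕ} (D : DayOps A n)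
    {ν : Fin k → ℕ} {a b : ∀ i, Fin (ν i) → A.carrier} {δ : Congruence A} {i₀ : Fin k}
    {step : (Fin (ν i₀) → A.carrier) → (Fin (ν i₀) → A.carrier) → Prop}
    (hstep : ∀ x y, step x y → (∀ m, δ.rel (x m) (y m)) ∨
      ∀ j, Centralizes (Function.update a i₀ x) (Function.update b i₀ y) j δ δ)
    (hab : Relation.ReflTransGen step (a i₀) (b i₀)) {j : Fin k} (hj : j ≠ i₀) :
    Centralizes a b j δ δ := by
  set H : Poly A (Σ i, Fin (ν i)) → (Fin (ν i₀) → A.carrier) → (Fin k → Bool) → A.carrier :=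
    fun p x => evalTup p (Function.update a i₀ x) (Function.update b i₀ x) with hH
  have key : ∀ (S : Finset (Fin k)) (j : Fin k), j ∉ S → i₀ ∉ S → j ≠ i₀ →
      ∀ p : Poly A (Σ i, Fin (ν i)),
      (∀ x f, (∃ i ∉ S, i ≠ i₀ ∧ i ≠ j ∧ f i = false) → LineRel δ (H p x) j f) →
      (∀ f, LineRel δ (H p (a i₀)) j f) →
      (∀ f, (∃ i ∈ S, f i = false) → LineRel δ (H p (b i₀)) j f) →
      LineRel δ (H p (b i₀)) j (fun _ => true) := by
    intro S
    induction S using Finset.induction_on with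
    | empty =>
      intro j _ _ hj p hp ha _
      suffices ∀ y, Relation.ReflTransGen step (a i₀) y → LineRel δ (H p y) j (fun _ => true) from
        this _ hab
      intro y hy
      induction hy with
      | refl => exact ha _
      | @tail x y _ hxy ih =>
        rcases hstep x y hxy with hδ | hC
        · have hxy' : ∀ f, δ.rel (H p x f) (H p y f) := by
            intro f
            refine p.eval_congr δ ?_
            rintro ⟨i, m⟩
            by_cases hi : i = i₀
            · subst hi
              simpa using hδ m
            · simpa [hi] using δ.iseqv.refl _
          exact δ.iseqv.trans (δ.iseqv.symm (hxy' _)) (δ.iseqv.trans ih (hxy' _))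
        · have h₀ : ∀ f : Fin k → Bool, f i₀ = false →
              evalTup p (Function.update a i₀ x) (Function.update b i₀ y) f = H p x f :=
            fun f hf => evalTup_update_of_eq_false p a b x y hf
          have h₁ : ∀ f : Fin k → Bool, f i₀ = true →
              evalTup p (Function.update a i₀ x) (Function.update b i₀ y) f = H p y f :=
            fun f hf => evalTup_update_of_eq_true p a b x y hf
          have := hC j p ?_
          · rwa [LineRel, h₁ _ (by simp [hj.symm]), h₁ _ (by simp [hj.symm])] at this
          · rintro f ⟨i, hij, hfi⟩
            cases hf : f i₀
            · rw [LineRel, h₀ _ (by simp [hj.symm, hf]), h₀ _ (by simp [hj.symm, hf])]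
              by_cases hex : ∃ i, i ≠ i₀ ∧ i ≠ j ∧ f i = false
              · obtain ⟨i, hi₀, hij, hfi⟩ := hex
                exact hp x f ⟨i, by simp, hi₀, hij, hfi⟩
              · have hind : ∀ v, H p x (Function.update f j v) =
                    H p x (Function.update (fun _ => true) j v) := by
                  intro v
                  refine evalTup_congr_env p fun i => ?_
                  by_cases hi : i = i₀
                  · subst hi
                    simp
                  · by_cases hij : i = j
                    · simp [hij]
                    · have : f i = true := by
                        by_contra hfi
                        exact hex ⟨i, hi, hij, by simpa using hfi⟩
                      simp [hij, this]
                rw [hind, hind]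
                exact ih
            · rw [LineRel, h₁ _ (by simp [hj.symm, hf]), h₁ _ (by simp [hj.symm, hf])]
              exact hp y f ⟨i, by simp, fun h => by simp [h, hf] at hfi, hij, hfi⟩
    | insert l S hl ih =>
      intro j hjS hi₀ hj p hp ha hb
      have hjl : j ≠ l := fun h => hjS (by simp [h])
      have hl₀ : l ≠ i₀ := fun h => hi₀ (by simp [h])
      refine lineRel_of_rotate D hjl δ (hb _ ⟨l, by simp, by simp⟩) fun e => ?_
      obtain ⟨q, hq⟩ := exists_evalTup_eq_rotate (j := j) (l := l) D e p a b
      have hqH : ∀ x, H q x = rotate D e j l (H p x) := fun x =>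
        hq _ _ (Function.update_of_ne hj _ _) (Function.update_of_ne hl₀ _ _)
      rw [← hqH]
      refine ih l hl (fun h => hi₀ (by simp [h])) hl₀ q ?_ ?_ ?_
      · rintro x f ⟨i, hiS, hii, hil, hfi⟩
        rw [hqH]
        by_cases hij : i = j
        · subst hij
          exact lineRel_rotate_of_eq_false D hjl e δ _ hfi
        · exact lineRel_rotate D hjl e δ
            (hp x _ ⟨i, by simp [hil, hiS], hii, hij, by simp [hil, hfi]⟩)
            (hp x _ ⟨i, by simp [hil, hiS], hii, hij, by simp [hil, hfi]⟩)
      · intro f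
        rw [hqH]
        exact lineRel_rotate D hjl e δ (ha _) (ha _)
      · rintro f ⟨i, hiS, hfi⟩
        have hil : i ≠ l := fun h => hl (h ▸ hiS)
        rw [hqH]
        exact lineRel_rotate D hjl e δ
          (hb _ ⟨i, by simp [hiS], by simp [hil, hfi]⟩)
          (hb _ ⟨i, by simp [hiS], by simp [hil, hfi]⟩)
  intro p hp
  have h₀ : ∀ f : Fin k → Bool, f i₀ = false → evalTup p a b f = H p (a i₀) f :=
    fun f hf => by simpa [hH] using evalTup_update_of_eq_false p a b (a i₀) (b i₀) hf
  have h₁ : ∀ f : Fin k → Bool, f i₀ = true → evalTup p a b f = H p (b i₀) f :=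
    fun f hf => by simpa [hH] using evalTup_update_of_eq_true p a b (a i₀) (b i₀) hf
  have := key ((Finset.univ.erase j).erase i₀) j (by simp) (by simp) hj p ?_ ?_ ?_
  · rwa [LineRel, h₁ _ (by simp [hj.symm]), h₁ _ (by simp [hj.symm])]
  · rintro x f ⟨i, hi, hii, hij, -⟩
    simp [hij, hii] at hi
  · intro f
    have := hp (Function.update f i₀ false) ⟨i₀, hj.symm, by simp⟩
    rw [LineRel, h₀ _ (by simp [hj.symm]), h₀ _ (by simp [hj.symm])] at this
    have hind : ∀ v, H p (a i₀) (Function.update (Function.update f i₀ false) j v) =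
        H p (a i₀) (Function.update f j v) := by
      intro v
      refine evalTup_congr_env p fun i => ?_
      by_cases hi : i = i₀
      · subst hi
        simp
      · by_cases hij : i = j
        · simp [hij]
        · simp [hij, hi]
    rwa [hind, hind] at this
  · rintro f ⟨i, hi, hfi⟩
    simp only [Finset.mem_erase, Finset.mem_univ, and_true] at hi
    have := hp (Function.update f i₀ true) ⟨i, hi.2, by simp [hi.1, hfi]⟩
    rw [LineRel, h₁ _ (by simp [hj.symm]), h₁ _ (by simp [hj.symm])] at this
    have hind : ∀ v, H p (b i₀) (Function.update (Function.update f i₀ true) j v) =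
        H p (b i₀) (Function.update f j v) := by
      intro v
      refine evalTup_congr_env p fun i => ?_
      by_cases hi : i = i₀
      · subst hi
        simp
      · by_cases hij : i = j
        · simp [hij]
        · simp [hij, hi]
    rwa [hind, hind] at this

/-! ### Joins of congruences -/

theorem reflTransGen_pi {ι X : Type*} [Fintype ι] [DecidableEq ι] {r : X → X → Prop}
    {x y : ι → X} (h : ∀ i, Relation.ReflTransGen r (x i) (y i)) :
    Relation.ReflTransGen
      (fun u v : ι → X => ∃ i c, r (u i) c ∧ v = Function.update u i c) x y := by
  have key : ∀ S : Finset ι, Relation.ReflTransGen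
      (fun u v : ι → X => ∃ i c, r (u i) c ∧ v = Function.update u i c) x
      (fun i => if i ∈ S then y i else x i) := by
    intro S
    induction S using Finset.induction_on with
    | empty => simpa using Relation.ReflTransGen.refl
    | insert j S hj ih =>
      refine ih.trans ?_
      have step := Relation.ReflTransGen.lift
        (p := fun u v : ι → X => ∃ i c, r (u i) c ∧ v = Function.update u i c)
        (fun c => Function.update (fun i => if i ∈ S then y i else x i) j c)
        (fun c d hcd => ⟨j, d, by simpa using hcd, by simp⟩) _ _ (h j)
      convert step using 1
      · symm
        rw [Function.update_eq_self_iff]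
        simp [hj]
      · funext i
        by_cases hi : i = j
        · subst hi
          simp
        · simp [hi]
  simpa using key Finset.univ

theorem reflTransGen_of_joinCong {σ : Signature} {A : Alg σ} {α β : Congruence A}
    {x y : A.carrier} (h : (joinCong α β).rel x y) :
    Relation.ReflTransGen (fun u v => α.rel u v ∨ β.rel u v) x y := by
  refine h ⟨⟨Relation.ReflTransGen (fun u v => α.rel u v ∨ β.rel u v), ⟨fun _ => .refl,
    fun h => ?_, fun h h' => h.trans h'⟩, fun o u v huv => ?_⟩, fun _ _ h => .single h⟩
  · have : Std.Symm (fun u v => α.rel u v ∨ β.rel u v) :=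
      ⟨fun _ _ h => h.imp α.iseqv.symm β.iseqv.symm⟩
    exact Relation.ReflTransGen.stdSymm.symm _ _ h
  · refine Relation.ReflTransGen.lift (A.interp o) ?_ _ _ (reflTransGen_pi huv)
    rintro s _ ⟨i, c, hc, rfl⟩
    have aux : ∀ γ : Congruence A, γ.rel (s i) c →
        γ.rel (A.interp o s) (A.interp o (Function.update s i c)) := by
      intro γ hγ
      refine γ.compat o _ _ fun m => ?_
      by_cases hm : m = i
      · subst hm
        simpa using hγ
      · simpa [hm] using γ.iseqv.refl _
    exact hc.imp (aux α) (aux β)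

/-! ### The term condition -/

theorem TC.commTC {σ : Signature} {A : Alg σ} {k : ℕ} (α : Fin k → Congruence A)
    (j : Fin k) : TC α j (commTC α j) :=
  fun ν p a b hab hp d => d.2 ν p a b hab fun g hg hgi => hp g hg hgi d

theorem TC.change_direction {σ : Signature} {A : Alg σ} {n k : ℕ} (D : DayOps A n)
    {α : Fin k → Congruence A} {δ : Congruence A} {l : Fin k} (h : TC α l δ) (j : Fin k) :
    TC α j δ := by
  by_cases hjl : j = l
  · rwa [hjl]
  · rw [TC_iff_centralizes] at h ⊢
    exact fun ν a b hab => (h ν a b hab).change_direction D hjl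

theorem TC.mono {σ : Signature} {A : Alg σ} {n k : ℕ} (D : DayOps A n)
    {α : Fin k → Congruence A} {δ₀ δ : Congruence A} {j : Fin k} (h : TC α j δ₀)
    (hδ : δ₀ ≤ δ) : TC α j δ :=
  TC_iff_centralizes.2 fun ν a b hab => Centralizes.mono D hδ
    (fun l => TC_iff_centralizes.1 (h.change_direction D l) ν a b hab) j

theorem TC.update_joinCong {σ : Signature} {A : Alg σ} {n k : ℕ} (D : DayOps A n)
    {α : Fin k → Congruence A} {δ π : Congruence A} {l i₀ : Fin k} (hl : l ≠ i₀)
    (h : TC α l δ) (hπ : π ≤ δ) :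
    TC (Function.update α i₀ (joinCong (α i₀) π)) l δ := by
  refine TC_iff_centralizes.2 fun ν a b hab => ?_
  have hchain := reflTransGen_pi fun m => reflTransGen_of_joinCong (by simpa using hab i₀ m)
  refine Centralizes.of_reflTransGen D ?_ hchain hl
  rintro x _ ⟨m, c, hc, rfl⟩
  have aux : ∀ γ : Congruence A, γ.rel (x m) c →
      ∀ m', γ.rel (x m') (Function.update x m c m') := by
    intro γ hγ m'
    by_cases hm : m' = m
    · subst hm
      simpa using hγ
    · simpa [hm] using γ.iseqv.refl _
  rcases hc with hc | hc
  · refine .inr fun j => TC_iff_centralizes.1 (h.change_direction D j) ν _ _ fun i m' => ?_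
    by_cases hi : i = i₀
    · subst hi
      simpa using aux _ hc m'
    · simpa [hi] using hab i m'
  · exact .inl (aux δ (hπ _ _ hc))

theorem TC.joinCong {σ : Signature} {A : Alg σ} {n k : ℕ} (D : DayOps A n) (hk : 2 ≤ k)
    {α : Fin k → Congruence A} {δ π : Congruence A} {l : Fin k} (h : TC α l δ) (hπ : π ≤ δ) :
    TC (fun i => joinCong (α i) π) l δ := by
  have key : ∀ S : Finset (Fin k),
      TC (fun i => if i ∈ S then UACommutator.joinCong (α i) π else α i) l δ := by
    intro S
    induction S using Finset.induction_on with
    | empty => simpa using h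
    | insert i₀ S hi₀ ih =>
      have : Nontrivial (Fin k) := Fin.nontrivial_iff_two_le.2 hk
      obtain ⟨j, hj⟩ := exists_ne i₀
      have := ((ih.change_direction D j).update_joinCong D hj hπ).change_direction D l
      convert this using 1
      funext i
      by_cases hi : i = i₀
      · subst hi
        simp [hi₀]
      · simp [hi]
  simpa using key Finset.univ

theorem TC.comapCong {σ : Signature} {A B : Alg σ} {f : A.carrier → B.carrier}
    (hf : IsHom A B f) {k : ℕ} {α : Fin k → Congruence A} {β : Fin k → Congruence B}
    (hαβ : ∀ i x y, (α i).rel x y → (β i).rel (f x) (f y)) {j : Fin k} {δ : Congruence B}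
    (h : TC β j δ) : TC α j (comapCong f hf δ) := by
  intro ν p a b hab hp
  have := h ν (p.map f) (fun i m => f (a i m)) (fun i m => f (b i m))
    (fun i m => hαβ i _ _ (hab i m)) fun g hg hgi => by
      rw [evalTup_map hf, evalTup_map hf]
      exact hp g hg hgi
  rwa [evalTup_map hf, evalTup_map hf] at this

theorem rel_of_mapCong {σ : Signature} {A B : Alg σ} {f : A.carrier → B.carrier}
    (hf : IsHom A B f) (hs : Function.Surjective f) {γ : Congruence A}
    (hγ : ∀ x y, f x = f y → γ.rel x y) {x y : A.carrier}
    (h : (mapCong f hf hs γ hγ).rel (f x) (f y)) : γ.rel x y := by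
  obtain ⟨x', y', hxy, hx, hy⟩ := h
  exact γ.iseqv.trans (hγ _ _ hx.symm) (γ.iseqv.trans hxy (hγ _ _ hy))

theorem TC.mapCong {σ : Signature} {A B : Alg σ} {f : A.carrier → B.carrier}
    (hf : IsHom A B f) (hs : Function.Surjective f) {k : ℕ} {α : Fin k → Congruence A}
    (hα : ∀ i x y, f x = f y → (α i).rel x y) {j : Fin k} {δ : Congruence A}
    (hδ : ∀ x y, f x = f y → δ.rel x y) (h : TC α j δ) :
    TC (fun i => mapCong f hf hs (α i) (hα i)) j (mapCong f hf hs δ hδ) := by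
  intro ν p a b hab hp
  obtain ⟨p, rfl⟩ := Poly.map_surjective hs p
  choose a' b' hab' ha hb using hab
  obtain rfl : (fun i m => f (a' i m)) = a := funext fun i => funext fun m => ha i m
  obtain rfl : (fun i m => f (b' i m)) = b := funext fun i => funext fun m => hb i m
  rw [evalTup_map hf, evalTup_map hf]
  refine ⟨_, _, h ν p a' b' hab' fun g hg hgi => ?_, rfl, rfl⟩
  have := hp g hg hgi
  rw [evalTup_map hf, evalTup_map hf] at this
  exact rel_of_mapCong hf hs hδ this

theorem commutator_hom_property {σ : Signature} (A B : Alg σ)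
    (f : A.carrier → B.carrier) (hf : IsHom A B f) (hs : Function.Surjective f)
    (n : ℕ) (D : DayOps A n) (k : ℕ) (hk : 2 ≤ k) (θ : Fin k → Congruence A) :
    joinCong (commTC θ ⟨k-1, by omega⟩) (kerCong f hf) =
      comapCong f hf
        (commTC
          (fun i => mapCong f hf hs (joinCong (θ i) (kerCong f hf))
            (fun x y hxy => Cg_base _ (Or.inr hxy)))
          ⟨k-1, by omega⟩) := by
  refine Congruence.ext_rel fun x y => ⟨fun h => ?_, fun h => ?_⟩
  · refine h ⟨_, fun u v huv => ?_⟩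
    rcases huv with huv | huv
    · intro d
      refine huv ⟨comapCong f hf d.1, TC.comapCong hf (fun i x y hxy => ?_) d.2⟩
      exact ⟨x, y, Cg_base _ (.inl hxy), rfl, rfl⟩
    · have huv : f u = f v := huv
      show (commTC _ _).rel (f u) (f v)
      rw [huv]
      exact (commTC _ _).iseqv.refl _
  · have hδ : TC θ ⟨k - 1, by omega⟩
        (joinCong (commTC θ ⟨k - 1, by omega⟩) (kerCong f hf)) :=
      (TC.commTC θ _).mono D fun u v huv => Cg_base _ (.inl huv)
    exact rel_of_mapCong hf hs (fun u v huv => Cg_base _ (.inr huv)) (h ⟨_, TC.mapCong hf hs _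
      (fun u v huv => Cg_base _ (.inr huv))
      (hδ.joinCong D hk fun u v huv => Cg_base _ (.inr huv))⟩)

end UACommutator
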